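/- arXiv:2204.13732 — 8 statements merged into one kernel-verified Lean document; each statement's English description precedes it below -/
import Mathlib

section
/- Let c ∈ (0,1), α > 0, e_0 > 0, and for ε ∈ (0, 2e_0) define K(ε) := ⌈log(ε/(2e_0))/log(c)⌉ and l̄_K(ε) := (2(1 − ε/(2e_0))/((1−c)ε))^{1/α}. Then the single-level cost satisfies cost_SL(ε) := K(ε)·l̄_K(ε) ≃ log(ε^{-1})·ε^{-1/α} as ε → 0; that is, there exist constants 0 < c_1 ≤ c_2 and ε_0 > 0 such that c_1·log(ε^{-1})·ε^{-1/α} ≤ K(ε)·l̄_K(ε) ≤ c_2·log(ε^{-1})·ε^{-1/α} for all ε ∈ (0, ε_0). -/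
/-- Once `L` dominates `D` and `l`, the ceiling of `(L + D) / l` is comparable to `L / l`. -/
theorem natCeil_add_div_bounds {L D l : ℝ} (hl : 0 < l) (hL : 2 * |D| + 2 * l ≤ L) :
    1 / (2 * l) * L ≤ (⌈(L + D) / l⌉₊ : ℝ) ∧ (⌈(L + D) / l⌉₊ : ℝ) ≤ 2 / l * L := by
  have h1 := neg_abs_le D
  have h2 := le_abs_self D
  have h3 := abs_nonneg D
  constructor
  · refine le_trans ?_ (Nat.le_ceil _)
    rw [div_mul_eq_mul_div, div_le_div_iff₀ (by positivity) hl]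
    nlinarith
  · have hpos : 0 ≤ (L + D) / l := div_nonneg (by linarith) hl.le
    refine (Nat.ceil_lt_add_one hpos).le.trans ?_
    rw [div_add_one hl.ne', div_mul_eq_mul_div]
    exact div_le_div_of_nonneg_right (by linarith) hl.le

theorem level_rpow_bounds {c e₀ ε p : ℝ} (hc : c < 1) (he₀ : 0 < e₀) (hε : 0 < ε)
    (hεe : ε ≤ e₀) (hp : 0 ≤ p) :
    (1 / (1 - c)) ^ p * ε ^ (-p) ≤ (2 * (1 - ε / (2 * e₀)) / ((1 - c) * ε)) ^ p ∧
      (2 * (1 - ε / (2 * e₀)) / ((1 - c) * ε)) ^ p ≤ (2 / (1 - c)) ^ p * ε ^ (-p) := by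
  have hc' : 0 < 1 - c := by linarith
  have hhalf : ε / (2 * e₀) ≤ 1 / 2 := by
    rw [div_le_div_iff₀ (by positivity) two_pos]; linarith
  have hnn : 0 ≤ ε / (2 * e₀) := by positivity
  rw [Real.rpow_neg hε.le, ← Real.inv_rpow hε.le,
    ← Real.mul_rpow (by positivity) (by positivity),
    ← Real.mul_rpow (by positivity) (by positivity),
    ← div_eq_mul_inv, ← div_eq_mul_inv, div_div, div_div]
  have hd : 0 < (1 - c) * ε := by positivity
  constructor
  · exact Real.rpow_le_rpow (by positivity)
      (div_le_div_of_nonneg_right (by linarith) hd.le) hp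
  · exact Real.rpow_le_rpow (div_nonneg (by linarith) hd.le)
      (div_le_div_of_nonneg_right (by linarith) hd.le) hp


/-- Single-level cost asymptotics: cost_SL(ε) = K(ε)·l̄_K(ε) ≃ log(ε⁻¹)·ε^{-1/α} as ε → 0. -/
theorem stmt2 (c α e₀ : ℝ) (hc : c ∈ Set.Ioo (0:ℝ) 1) (hα : 0 < α) (he₀ : 0 < e₀)
    (K : ℝ → ℕ) (hK : ∀ ε, K ε = ⌈Real.log (ε / (2 * e₀)) / Real.log c⌉₊)
    (lbar : ℝ → ℝ)
    (hlbar : ∀ ε, lbar ε = (2 * (1 - ε / (2 * e₀)) / ((1 - c) * ε)) ^ (1/α)) :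
    ∃ c₁ c₂ ε₀ : ℝ, 0 < c₁ ∧ c₁ ≤ c₂ ∧ 0 < ε₀ ∧
      ∀ ε, 0 < ε → ε < ε₀ →
        c₁ * Real.log ε⁻¹ * ε ^ (-1/α) ≤ (K ε : ℝ) * lbar ε ∧
        (K ε : ℝ) * lbar ε ≤ c₂ * Real.log ε⁻¹ * ε ^ (-1/α) := by
  obtain ⟨hc0, hc1⟩ := hc
  have hl : 0 < -Real.log c := neg_pos.mpr (Real.log_neg hc0 hc1)
  have hc' : 0 < 1 - c := by linarith
  have hp : 0 ≤ 1 / α := by positivity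
  set l := -Real.log c with hl_def
  set D := Real.log (2 * e₀) with hD
  refine ⟨1 / (2 * l) * (1 / (1 - c)) ^ (1 / α), 2 / l * (2 / (1 - c)) ^ (1 / α),
    min e₀ (Real.exp (-(2 * |D| + 2 * l))), by positivity, ?_, by positivity, ?_⟩
  · refine mul_le_mul ?_ (Real.rpow_le_rpow (by positivity) ?_ hp) (by positivity) (by positivity)
    · rw [div_le_div_iff₀ (by positivity) hl]
      linarith
    · exact div_le_div_of_nonneg_right (by norm_num) hc'.le
  · intro ε hε hlt
    obtain ⟨hεe, hεexp⟩ := lt_min_iff.mp hlt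
    have hL : 2 * |D| + 2 * l ≤ Real.log ε⁻¹ := by
      have h := (Real.log_lt_iff_lt_exp hε).mpr hεexp
      rw [Real.log_inv]
      linarith
    have hLpos : 0 < Real.log ε⁻¹ := by linarith [abs_nonneg D]
    have hx : Real.log (ε / (2 * e₀)) / Real.log c = (Real.log ε⁻¹ + D) / l := by
      rw [Real.log_div hε.ne' (by positivity), Real.log_inv, hl_def, ← neg_div_neg_eq]
      congr 1
      ring
    obtain ⟨hK₁, hK₂⟩ := natCeil_add_div_bounds hl hL
    obtain ⟨hl₁, hl₂⟩ := level_rpow_bounds hc1 he₀ hε hεe.le hp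
    rw [← hx, ← hK] at hK₁ hK₂
    rw [← hlbar, ← neg_div] at hl₁ hl₂
    constructor
    · calc _ = 1 / (2 * l) * Real.log ε⁻¹ * ((1 / (1 - c)) ^ (1 / α) * ε ^ (-1 / α)) := by ring
        _ ≤ _ := mul_le_mul hK₁ hl₁ (by positivity) (Nat.cast_nonneg _)
    · have hlnn : 0 ≤ lbar ε := le_trans (by positivity) hl₁
      calc _ ≤ 2 / l * Real.log ε⁻¹ * ((2 / (1 - c)) ^ (1 / α) * ε ^ (-1 / α)) :=
            mul_le_mul hK₂ hl₂ hlnn (by positivity)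
        _ = _ := by ring
end

section
/- Let c ∈ (0,1), α > 0, e_0 > 0, and for K ∈ ℕ and l > 0 define ẽ_K(l) := c^K·e_0 + l^{-α}·Σ_{j=0}^{K-1} c^{K-1-j}. Let ε ∈ (0, e_0), and define K(ε) := ⌈log(ε/(2e_0))/log(c)⌉ and l̄_K(ε) := (2(1 − ε/(2e_0))/((1−c)ε))^{1/α}. Then any K̂ ∈ ℕ and l̂ > 0 with ẽ_{K̂}(l̂) ≤ ε satisfy K̂ ≥ K(2ε) and l̂ ≥ l̄_K(2ε); consequently K(2ε)·l̄_K(2ε) ≤ inf{ K̂·l̂ : ẽ_{K̂}(l̂) ≤ ε } ≤ K(ε)·l̄_K(ε). -/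
/-- The iteration counts reaching the accuracy `y` are those above `log y / log c`. -/
theorem ceil_log_div_log_le_iff {c y : ℝ} (hc0 : 0 < c) (hc1 : c < 1) (hy : 0 < y) (n : ℕ) :
    ⌈Real.log y / Real.log c⌉₊ ≤ n ↔ c ^ n ≤ y := by
  rw [Nat.ceil_le, div_le_iff_of_neg (Real.log_neg hc0 hc1), ← Real.log_pow,
    Real.log_le_log_iff (pow_pos hc0 n) hy]

theorem one_sub_mul_sum_pow_reflect (c : ℝ) (n : ℕ) :
    (1 - c) * ∑ j ∈ Finset.range n, c ^ (n - 1 - j) = 1 - c ^ n := by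
  rw [Finset.sum_range_reflect (fun j => c ^ j) n, mul_neg_geom_sum]

/-- Quasi-optimality of the single-level choice: any feasible (K̂, l̂) dominates
(K(2ε), l̄_K(2ε)), giving a sandwich on the infimal single-level cost. -/
theorem stmt3 (c α e₀ : ℝ) (hc : c ∈ Set.Ioo (0:ℝ) 1) (hα : 0 < α) (he₀ : 0 < e₀)
    (etil : ℕ → ℝ → ℝ)
    (hetil : ∀ (K : ℕ) (l : ℝ),
      etil K l = c ^ K * e₀ + l ^ (-α) * ∑ j ∈ Finset.range K, (c:ℝ) ^ (K - 1 - j))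
    (K : ℝ → ℕ) (hK : ∀ ε, K ε = ⌈Real.log (ε / (2 * e₀)) / Real.log c⌉₊)
    (lbar : ℝ → ℝ)
    (hlbar : ∀ ε, lbar ε = (2 * (1 - ε / (2 * e₀)) / ((1 - c) * ε)) ^ (1/α))
    (ε : ℝ) (hε : 0 < ε) (hεe : ε < e₀) :
    (∀ (Kh : ℕ) (lh : ℝ), 0 < lh → etil Kh lh ≤ ε →
      K (2*ε) ≤ Kh ∧ lbar (2*ε) ≤ lh) ∧
    (K (2*ε) : ℝ) * lbar (2*ε) ≤
      sInf {x : ℝ | ∃ (Kh : ℕ) (lh : ℝ), 0 < lh ∧ etil Kh lh ≤ ε ∧ x = Kh * lh} ∧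
    sInf {x : ℝ | ∃ (Kh : ℕ) (lh : ℝ), 0 < lh ∧ etil Kh lh ≤ ε ∧ x = Kh * lh} ≤
      (K ε : ℝ) * lbar ε := by
  obtain ⟨hc0, hc1⟩ := hc
  have h1c : 0 < 1 - c := sub_pos.2 hc1
  have hKε : K (2 * ε) = ⌈Real.log (ε / e₀) / Real.log c⌉₊ := by
    rw [hK, mul_div_mul_left _ _ two_ne_zero]
  have hlε : lbar (2 * ε) = ((1 - ε / e₀) / ((1 - c) * ε)) ^ (1 / α) := by
    rw [hlbar, mul_div_mul_left _ _ two_ne_zero, mul_left_comm,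
      mul_div_mul_left _ _ two_ne_zero]
  have hr : ε / e₀ < 1 := (div_lt_one he₀).2 hεe
  have hbase : 0 < (1 - ε / e₀) / ((1 - c) * ε) :=
    div_pos (sub_pos.2 hr) (mul_pos h1c hε)
  have lower : ∀ (Kh : ℕ) (lh : ℝ), 0 < lh → etil Kh lh ≤ ε →
      K (2 * ε) ≤ Kh ∧ lbar (2 * ε) ≤ lh := by
    intro n l hl h
    rw [hetil] at h
    have hg := one_sub_mul_sum_pow_reflect c n
    set S := ∑ j ∈ Finset.range n, c ^ (n - 1 - j)
    have hS : 0 ≤ S := Finset.sum_nonneg fun _ _ => (pow_pos hc0 _).le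
    have ha : 0 < l ^ (-α) := Real.rpow_pos_of_pos hl _
    have hx : 0 < c ^ n := pow_pos hc0 n
    have hxe : c ^ n ≤ ε / e₀ := by
      rw [le_div_iff₀ he₀]
      linarith [mul_nonneg ha.le hS]
    refine ⟨by rwa [hKε, ceil_log_div_log_le_iff hc0 hc1 (div_pos hε he₀)], ?_⟩
    have hb : 0 < l ^ α := Real.rpow_pos_of_pos hl _
    have key : l ^ (-α) * (1 - ε / e₀) ≤ (1 - c) * ε := calc
      l ^ (-α) * (1 - ε / e₀) ≤ l ^ (-α) * (1 - c ^ n) := by gcongr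
      _ = (1 - c) * (l ^ (-α) * S) := by rw [← hg]; ring
      _ ≤ (1 - c) * ε := by
        gcongr
        linarith [mul_pos hx he₀]
    rw [hlε, one_div, Real.rpow_inv_le_iff_of_pos hbase.le hl.le hα,
      div_le_iff₀ (mul_pos h1c hε)]
    rwa [Real.rpow_neg hl.le, inv_mul_le_iff₀ hb] at key
  have hδ : ε / (2 * e₀) < 1 := (div_lt_one (by positivity)).2 (by linarith)
  have hδ0 : 0 < 1 - ε / (2 * e₀) := sub_pos.2 hδ
  have hbase' : 0 < 2 * (1 - ε / (2 * e₀)) / ((1 - c) * ε) := by positivity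
  have hlpos : 0 < lbar ε := by
    rw [hlbar]
    exact Real.rpow_pos_of_pos hbase' _
  have feasible : etil (K ε) (lbar ε) ≤ ε := by
    have hx : c ^ K ε ≤ ε / (2 * e₀) :=
      (ceil_log_div_log_le_iff hc0 hc1 (by positivity) _).1 (hK ε).ge
    have hp : lbar ε ^ (-α) = (1 - c) * ε / (2 * (1 - ε / (2 * e₀))) := by
      rw [hlbar, ← Real.rpow_mul hbase'.le, show 1 / α * -α = -1 by field_simp,
        Real.rpow_neg_one, inv_div]
    have hg := one_sub_mul_sum_pow_reflect c (K ε)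
    rw [hetil, hp]
    set S := ∑ j ∈ Finset.range (K ε), c ^ (K ε - 1 - j)
    set x := c ^ K ε
    have hδe : ε = 2 * e₀ * (ε / (2 * e₀)) := by field_simp
    set δ := ε / (2 * e₀)
    have hδ2 : 2 * δ ≤ 1 := by nlinarith
    have e1 : (1 - c) * ε / (2 * (1 - δ)) * S = ε * (1 - x) / (2 * (1 - δ)) := by
      rw [← hg]; ring
    have e2 : ε * (1 - x) / (2 * (1 - δ)) ≤ ε - x * e₀ := by
      rw [div_le_iff₀ (by positivity)]
      have := mul_nonneg he₀.le (mul_nonneg (sub_nonneg.2 hx) (sub_nonneg.2 hδ2))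
      rw [hδe]
      linarith
    linarith
  have mem : (K ε : ℝ) * lbar ε ∈
      {x : ℝ | ∃ (Kh : ℕ) (lh : ℝ), 0 < lh ∧ etil Kh lh ≤ ε ∧ x = Kh * lh} :=
    ⟨K ε, lbar ε, hlpos, feasible, rfl⟩
  have hlb : (K (2 * ε) : ℝ) * lbar (2 * ε) ∈ lowerBounds
      {x : ℝ | ∃ (Kh : ℕ) (lh : ℝ), 0 < lh ∧ etil Kh lh ≤ ε ∧ x = Kh * lh} := by
    rintro _ ⟨n, l, hl, h, rfl⟩
    obtain ⟨h1, h2⟩ := lower n l hl h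
    have h0 : 0 ≤ lbar (2 * ε) := by
      rw [hlε]
      exact Real.rpow_nonneg hbase.le _
    gcongr
  exact ⟨lower, le_csInf ⟨_, mem⟩ hlb, csInf_le ⟨_, hlb⟩ mem⟩
end

section
/- Let c ∈ (0,1), α > 0, K ∈ ℕ with K ≥ 1, and ε > 0. Then the levels l_{K,j} := C_{K,ε}·c^{(K-1-j)/(1+α)} for j = 0,…,K−1, with C_{K,ε} := (ε/2)^{-1/α}·((1 − c^{K/(1+α)})/(1 − c^{1/(1+α)}))^{1/α}, minimize the total cost Σ_{j=0}^{K-1} l_j over all positive sequences (l_j)_{j=0}^{K-1} subject to the constraint Σ_{j=0}^{K-1} c^{K-1-j}·l_j^{-α} ≤ ε/2; moreover this choice attains the constraint with equality. -/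
/-- The tangent line of the convex function `t ↦ t ^ (-α)` at `1` lies below it. -/
theorem one_sub_mul_le_rpow_neg {α t : ℝ} (hα : 0 ≤ α) (ht : 0 < t) :
    1 - α * (t - 1) ≤ t ^ (-α) := by
  rw [Real.rpow_def_of_pos ht]
  have h1 := Real.add_one_le_exp (Real.log t * -α)
  have h2 := mul_le_mul_of_nonneg_left (Real.log_le_sub_one_of_pos ht) hα
  linarith

theorem rpow_one_add_mul_mul_rpow_neg {α C r : ℝ} (hC : 0 ≤ C) (hr : 0 < r) :
    r ^ (1 + α) * (C * r) ^ (-α) = C ^ (-α) * r := by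
  rw [Real.mul_rpow hC hr.le, mul_left_comm, ← Real.rpow_add hr, add_neg_cancel_right,
    Real.rpow_one]

/-- Among positive `l` with `∑ r i ^ (1 + α) * l i ^ (-α) ≤ C ^ (-α) * ∑ r i`, the choice
`l i = C * r i` has the smallest sum. -/
theorem sum_mul_le_sum_of_sum_rpow_le {ι : Type*} (s : Finset ι) {α C : ℝ} (hα : 0 < α)
    (hC : 0 < C) (r l : ι → ℝ) (hr : ∀ i ∈ s, 0 < r i) (hl : ∀ i ∈ s, 0 < l i)
    (h : ∑ i ∈ s, r i ^ (1 + α) * l i ^ (-α) ≤ C ^ (-α) * ∑ i ∈ s, r i) :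
    ∑ i ∈ s, C * r i ≤ ∑ i ∈ s, l i := by
  have hpos : 0 < C ^ (-α) := Real.rpow_pos_of_pos hC _
  have hterm : ∀ i ∈ s, C ^ (-α) * ((1 + α) * r i - α * (l i / C)) ≤
      r i ^ (1 + α) * l i ^ (-α) := by
    intro i hi
    have hri := hr i hi
    have hCr : 0 < C * r i := mul_pos hC hri
    have ht : 0 < l i / (C * r i) := div_pos (hl i hi) hCr
    calc C ^ (-α) * ((1 + α) * r i - α * (l i / C))
        = C ^ (-α) * r i * (1 - α * (l i / (C * r i) - 1)) := by
          field_simp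
          ring
      _ ≤ C ^ (-α) * r i * (l i / (C * r i)) ^ (-α) := by
          gcongr
          exact one_sub_mul_le_rpow_neg hα.le ht
      _ = r i ^ (1 + α) * ((C * r i) * (l i / (C * r i))) ^ (-α) := by
          rw [← rpow_one_add_mul_mul_rpow_neg hC.le hri, Real.mul_rpow hCr.le ht.le, mul_assoc]
      _ = r i ^ (1 + α) * l i ^ (-α) := by
          rw [mul_div_cancel₀ _ hCr.ne']
  have hsum := (Finset.sum_le_sum hterm).trans h
  rw [← Finset.mul_sum, Finset.sum_sub_distrib, ← Finset.mul_sum, ← Finset.mul_sum,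
    ← Finset.sum_div] at hsum
  have h1 := le_of_mul_le_mul_left hsum hpos
  have h2 : ∑ i ∈ s, r i ≤ (∑ i ∈ s, l i) / C := by
    refine le_of_mul_le_mul_left ?_ hα
    linarith
  rw [← Finset.mul_sum, mul_comm]
  exact (le_div_iff₀ hC).1 h2

/-- The multilevel levels l_{K,j} minimize the total cost subject to the accumulated
discretization error constraint, and attain the constraint with equality. -/
theorem stmt4 (c α ε : ℝ) (hc : c ∈ Set.Ioo (0:ℝ) 1) (hα : 0 < α) (hε : 0 < ε)
    (K : ℕ) (hK : 1 ≤ K)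
    (C : ℝ) (hC : C = (ε/2) ^ (-1/α) *
      ((1 - c ^ ((K:ℝ)/(1+α))) / (1 - c ^ ((1:ℝ)/(1+α)))) ^ (1/α))
    (lK : ℕ → ℝ) (hlK : ∀ j, lK j = C * c ^ (((K:ℝ) - 1 - j)/(1+α))) :
    (∀ l : ℕ → ℝ, (∀ j < K, 0 < l j) →
      ∑ j ∈ Finset.range K, c ^ (K - 1 - j) * l j ^ (-α) ≤ ε/2 →
      ∑ j ∈ Finset.range K, lK j ≤ ∑ j ∈ Finset.range K, l j) ∧
    ∑ j ∈ Finset.range K, c ^ (K - 1 - j) * lK j ^ (-α) = ε/2 := by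
  obtain ⟨hc0, hc1⟩ := hc
  have hα1 : 0 < 1 + α := by linarith
  set q : ℝ := c ^ ((1:ℝ)/(1+α)) with hq
  have hq0 : 0 < q := Real.rpow_pos_of_pos hc0 _
  have hq1 : q < 1 := Real.rpow_lt_one hc0.le hc1 (by positivity)
  have hqpow (n : ℕ) : c ^ ((n:ℝ)/(1+α)) = q ^ n := by
    rw [hq, ← Real.rpow_mul_natCast hc0.le, one_div_mul_eq_div]
  have hcpow (n : ℕ) : c ^ n = (q ^ n) ^ (1 + α) := by
    rw [← hqpow, ← Real.rpow_mul hc0.le, div_mul_cancel₀ _ hα1.ne', Real.rpow_natCast]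
  have hlK' : ∀ j ∈ Finset.range K, lK j = C * q ^ (K - 1 - j) := by
    intro j hj
    have hj := Finset.mem_range.1 hj
    rw [hlK, ← hqpow, Nat.cast_sub (by omega), Nat.cast_sub hK, Nat.cast_one]
  have hS : ∑ j ∈ Finset.range K, q ^ (K - 1 - j) = (1 - q ^ K) / (1 - q) := by
    rw [Finset.sum_range_reflect (fun j => q ^ j) K, geom_sum_eq hq1.ne, ← neg_div_neg_eq,
      neg_sub, neg_sub]
  have hS0 : 0 < (1 - q ^ K) / (1 - q) :=
    div_pos (sub_pos.2 (pow_lt_one₀ hq0.le hq1 (by omega))) (sub_pos.2 hq1)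
  rw [hqpow] at hC
  have hε2 : 0 < ε / 2 := by positivity
  have hC0 : 0 < C := by
    rw [hC]
    positivity
  have hCα : C ^ (-α) * ∑ j ∈ Finset.range K, q ^ (K - 1 - j) = ε / 2 := by
    rw [hS, hC, Real.mul_rpow (by positivity) (by positivity), ← Real.rpow_mul hε2.le,
      ← Real.rpow_mul hS0.le, show -1 / α * -α = 1 by field_simp,
      show 1 / α * -α = -1 by field_simp, Real.rpow_one, Real.rpow_neg_one,
      inv_mul_cancel_right₀ hS0.ne']
  refine ⟨fun l hl h => ?_, ?_⟩
  · rw [Finset.sum_congr rfl hlK']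
    refine sum_mul_le_sum_of_sum_rpow_le _ hα hC0 _ l (fun _ _ => by positivity)
      (fun j hj => hl j (Finset.mem_range.1 hj)) ?_
    simpa only [hCα, ← hcpow] using h
  · rw [← hCα, Finset.mul_sum]
    refine Finset.sum_congr rfl fun j hj => ?_
    rw [hlK' j hj, hcpow, rpow_one_add_mul_mul_rpow_neg hC0.le (by positivity)]
end

section
/- Let c ∈ (0,1), α > 0, e_0 > 0, and for ε ∈ (0, e_0) define K(ε) := ⌈log(ε/(2e_0))/log(c)⌉ and l_{K,j}(ε) := (ε/2)^{-1/α}·c^{K(ε)/(1+α)}·c^{-(1+j)/(1+α)}·((1 − c^{K(ε)/(1+α)})/(1 − c^{1/(1+α)}))^{(1+α)/α} for j = 0,…,K(ε)−1. Then (i) the error bound satisfies ẽ_{K(ε)}((l_{K,j}(ε))_j) := c^{K(ε)}·e_0 + Σ_{j=0}^{K(ε)-1} c^{K(ε)-1-j}·l_{K,j}(ε)^{-α} ≤ ε, and (ii) the multilevel cost satisfies cost_ML(ε) := Σ_{j=0}^{K(ε)-1} l_{K,j}(ε) ≃ ε^{-1/α} as ε → 0, i.e. there exist constants 0 < c_1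 ≤ c_2 and ε_0 > 0 with c_1·ε^{-1/α} ≤ cost_ML(ε) ≤ c_2·ε^{-1/α} for all ε ∈ (0, ε_0). -/
/-- After `⌈log (ε / (2 e₀)) / log c⌉` contractions the initial error is at most `ε / 2`. -/
theorem pow_ceil_log_mul_le {c e₀ ε : ℝ} (hc0 : 0 < c) (hc1 : c < 1) (he₀ : 0 < e₀)
    (hε : 0 < ε) :
    c ^ ⌈Real.log (ε / (2 * e₀)) / Real.log c⌉₊ * e₀ ≤ ε / 2 := by
  set k := ⌈Real.log (ε / (2 * e₀)) / Real.log c⌉₊ with hk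
  have hlog : Real.log c < 0 := Real.log_neg hc0 hc1
  have hle : (k : ℝ) * Real.log c ≤ Real.log (ε / (2 * e₀)) :=
    (div_le_iff_of_neg hlog).1 (Nat.le_ceil _)
  have hpow : c ^ k ≤ ε / (2 * e₀) := by
    rw [← Real.log_le_log_iff (by positivity) (by positivity), Real.log_pow]
    exact hle
  calc c ^ k * e₀ ≤ ε / (2 * e₀) * e₀ := by gcongr
    _ = ε / 2 := by field_simp

/-- The number of contractions is positive when the tolerance is below the initial error. -/
theorem ceil_log_pos {c e₀ ε : ℝ} (hc0 : 0 < c) (hc1 : c < 1) (hε : 0 < ε) (hεe : ε < e₀) :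
    0 < ⌈Real.log (ε / (2 * e₀)) / Real.log c⌉₊ := by
  have he₀ : 0 < e₀ := hε.trans hεe
  refine Nat.ceil_pos.2 (div_pos_of_neg_of_neg (Real.log_neg (by positivity) ?_)
    (Real.log_neg hc0 hc1))
  rw [div_lt_one (by positivity)]
  linarith

theorem rpow_natCast_div_eq_pow {c : ℝ} (hc : 0 ≤ c) (β : ℝ) (n : ℕ) :
    c ^ ((n : ℝ) / β) = (c ^ (1 / β)) ^ n := by
  rw [← Real.rpow_mul_natCast hc]
  congr 1
  ring

theorem rpow_div_mul_rpow_neg_div {c : ℝ} (hc : 0 < c) (β : ℝ) {k j : ℕ} (hj : j < k) :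
    c ^ ((k : ℝ) / β) * c ^ (-(1 + (j : ℝ)) / β) = (c ^ (1 / β)) ^ (k - 1 - j) := by
  rw [← Real.rpow_add hc, ← rpow_natCast_div_eq_pow hc.le]
  congr 1
  have h : ((k - 1 - j : ℕ) : ℝ) = k - 1 - j := by
    rw [Nat.sub_sub, Nat.cast_sub (by omega)]
    push_cast
    ring
  rw [h]
  ring

theorem sum_pow_reflect_eq {q : ℝ} (hq : q ≠ 1) (k : ℕ) :
    ∑ j ∈ Finset.range k, q ^ (k - 1 - j) = (1 - q ^ k) / (1 - q) := by
  rw [Finset.sum_range_reflect (fun i => q ^ i) k, geom_sum_eq hq, ← neg_div_neg_eq]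
  simp

/-- The weighted contribution of a single level to the error bound. -/
theorem pow_mul_level_rpow_neg {c α δ S : ℝ} (hc : 0 < c) (hα : 0 < α) (hδ : 0 < δ)
    (hS : 0 < S) (m : ℕ) :
    c ^ m * (δ ^ (-1 / α) * (c ^ (1 / (1 + α))) ^ m * S ^ ((1 + α) / α)) ^ (-α) =
      δ * S ^ (-(1 + α)) * (c ^ (1 / (1 + α))) ^ m := by
  have hβ : 1 + α ≠ 0 := by positivity
  have h1 : (δ ^ (-1 / α)) ^ (-α) = δ := by
    rw [← Real.rpow_mul hδ.le, show -1 / α * -α = 1 by field_simp, Real.rpow_one]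
  have h2 : (S ^ ((1 + α) / α)) ^ (-α) = S ^ (-(1 + α)) := by
    rw [← Real.rpow_mul hS.le]
    congr 1
    field_simp
  have h3 : c ^ m * ((c ^ (1 / (1 + α))) ^ m) ^ (-α) = (c ^ (1 / (1 + α))) ^ m := by
    rw [← rpow_natCast_div_eq_pow hc.le, ← Real.rpow_mul hc.le, ← Real.rpow_natCast,
      ← Real.rpow_add hc]
    congr 1
    field_simp
    ring
  rw [Real.mul_rpow (by positivity) (by positivity), Real.mul_rpow (by positivity) (by positivity),
    h1, h2]
  linear_combination δ * S ^ (-(1 + α)) * h3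

/-- Multilevel convergence: the explicit level choice achieves error ≤ ε with
cost_ML(ε) ≃ ε^{-1/α} as ε → 0. -/
theorem stmt6 (c α e₀ : ℝ) (hc : c ∈ Set.Ioo (0:ℝ) 1) (hα : 0 < α) (he₀ : 0 < e₀)
    (K : ℝ → ℕ) (hK : ∀ ε, K ε = ⌈Real.log (ε / (2 * e₀)) / Real.log c⌉₊)
    (lev : ℝ → ℕ → ℝ)
    (hlev : ∀ ε j, lev ε j = (ε/2) ^ (-1/α) * c ^ ((K ε : ℝ)/(1+α)) *
        c ^ (-(1 + (j:ℝ))/(1+α)) *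
        ((1 - c ^ ((K ε : ℝ)/(1+α))) / (1 - c ^ ((1:ℝ)/(1+α)))) ^ ((1+α)/α)) :
    (∀ ε, 0 < ε → ε < e₀ →
      c ^ K ε * e₀ + ∑ j ∈ Finset.range (K ε), c ^ (K ε - 1 - j) * lev ε j ^ (-α) ≤ ε) ∧
    ∃ c₁ c₂ ε₀ : ℝ, 0 < c₁ ∧ c₁ ≤ c₂ ∧ 0 < ε₀ ∧
      ∀ ε, 0 < ε → ε < ε₀ →
        c₁ * ε ^ (-1/α) ≤ ∑ j ∈ Finset.range (K ε), lev ε j ∧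
        ∑ j ∈ Finset.range (K ε), lev ε j ≤ c₂ * ε ^ (-1/α) := by
  obtain ⟨hc0, hc1⟩ := hc
  set q : ℝ := c ^ ((1 : ℝ) / (1 + α)) with hq
  have hq0 : 0 < q := by positivity
  have hq1 : q < 1 := Real.rpow_lt_one hc0.le hc1 (by positivity)
  set S : ℝ → ℝ := fun ε => (1 - q ^ K ε) / (1 - q) with hS
  have hSsum (ε : ℝ) : ∑ j ∈ Finset.range (K ε), q ^ (K ε - 1 - j) = S ε :=
    sum_pow_reflect_eq hq1.ne _
  have hS1 (ε : ℝ) (hε : 0 < ε) (hεe : ε < e₀) : 1 ≤ S ε := by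
    have hk : K ε ≠ 0 := by
      rw [hK]
      exact (ceil_log_pos hc0 hc1 hε hεe).ne'
    rw [hS, one_le_div (by linarith)]
    linarith [pow_le_of_le_one hq0.le hq1.le hk]
  have hS2 (ε : ℝ) : S ε ≤ 1 / (1 - q) := by
    have : 0 < 1 - q := by linarith
    simp only [hS]
    gcongr
    linarith [pow_pos hq0 (K ε)]
  have hlevel (ε : ℝ) (j : ℕ) (hj : j ∈ Finset.range (K ε)) :
      lev ε j = (ε / 2) ^ (-1 / α) * q ^ (K ε - 1 - j) * S ε ^ ((1 + α) / α) := by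
    rw [hlev, mul_assoc ((ε / 2) ^ (-1 / α)),
      rpow_div_mul_rpow_neg_div hc0 _ (Finset.mem_range.1 hj), rpow_natCast_div_eq_pow hc0.le]
  constructor
  · intro ε hε hεe
    have hSpos : 0 < S ε := one_pos.trans_le (hS1 ε hε hεe)
    have hinit : c ^ K ε * e₀ ≤ ε / 2 := by
      rw [hK]
      exact pow_ceil_log_mul_le hc0 hc1 he₀ hε
    have hsum : ∑ j ∈ Finset.range (K ε), c ^ (K ε - 1 - j) * lev ε j ^ (-α) =
        ε / 2 * S ε ^ (-α) := by
      calc _ = ∑ j ∈ Finset.range (K ε), ε / 2 * S ε ^ (-(1 + α)) * q ^ (K ε - 1 - j) := by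
            refine Finset.sum_congr rfl fun j hj => ?_
            rw [hlevel ε j hj]
            exact pow_mul_level_rpow_neg hc0 hα (half_pos hε) hSpos _
        _ = ε / 2 * S ε ^ (-α) := by
            rw [← Finset.mul_sum, hSsum, mul_assoc, ← Real.rpow_add_one hSpos.ne']
            congr 2
            ring
    have hle : S ε ^ (-α) ≤ 1 :=
      Real.rpow_le_one_of_one_le_of_nonpos (hS1 ε hε hεe) (by linarith)
    rw [hsum]
    nlinarith
  · have hA : 0 < (1 / 2 : ℝ) ^ (-1 / α) := by positivity
    have hcost (ε : ℝ) (hε : 0 < ε) : ∑ j ∈ Finset.range (K ε), lev ε j =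
        (1 / 2 : ℝ) ^ (-1 / α) * (S ε * S ε ^ ((1 + α) / α)) * ε ^ (-1 / α) := by
      rw [Finset.sum_congr rfl (hlevel ε), ← Finset.sum_mul, ← Finset.mul_sum, hSsum,
        div_eq_mul_one_div ε 2, Real.mul_rpow hε.le (by norm_num)]
      ring
    have hr : 0 ≤ (1 + α) / α := by positivity
    have hT : 1 ≤ 1 / (1 - q) := by
      rw [one_le_div (by linarith)]
      linarith
    refine ⟨(1 / 2) ^ (-1 / α),
      (1 / 2) ^ (-1 / α) * (1 / (1 - q) * (1 / (1 - q)) ^ ((1 + α) / α)), e₀, hA, ?_, he₀,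
      fun ε hε hεe => ?_⟩
    · exact le_mul_of_one_le_right hA.le
        (one_le_mul_of_one_le_of_one_le hT (Real.one_le_rpow hT hr))
    · have h1 := hS1 ε hε hεe
      have h2 := hS2 ε
      rw [hcost ε hε]
      constructor
      · gcongr
        exact le_mul_of_one_le_right hA.le
          (one_le_mul_of_one_le_of_one_le h1 (Real.one_le_rpow h1 hr))
      · have h0 : 0 ≤ S ε := by linarith
        gcongr
end

section
/- Let c ∈ (0,1), α > 0, e_0 > 0, and for ε ∈ (0, e_0) define K(ε) := ⌈log(ε/(2e_0))/log(c)⌉. Let K̂ ∈ ℕ and (l̂_j)_{j=0}^{K̂-1} be any positive levels with ẽ_{K̂}((l̂_j)_j) := c^{K̂}·e_0 + Σ_{j=0}^{K̂-1} c^{K̂-1-j}·l̂_j^{-α} ≤ ε. Then K̂ ≥ K(2ε) and Σ_{j=0}^{K̂-1} l̂_j ≥ ε^{-1/α}·((1 − c^{K(2ε)/(1+α)})/(1 − c^{1/(1+α)}))^{(1+α)/α}. -/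
open Finset in
/-- Hölder's inequality bounding the cost of levels `l` below in terms of the weighted error. -/
theorem sum_rpow_le_weighted_error_mul_cost {ι : Type*} (s : Finset ι) {α : ℝ} (hα : 0 < α)
    (w l : ι → ℝ) (hw : ∀ j ∈ s, 0 ≤ w j) (hl : ∀ j ∈ s, 0 < l j) :
    (∑ j ∈ s, w j ^ (1 / (1 + α))) ^ ((1 + α) / α) ≤
      (∑ j ∈ s, w j * l j ^ (-α)) ^ (1 / α) * ∑ j ∈ s, l j := by
  have h1 : 0 < 1 + α := by positivity
  have hpq : (1 + α).HolderConjugate ((1 + α) / α) := by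
    rw [Real.holderConjugate_iff]
    refine ⟨by linarith, ?_⟩
    field_simp
  have hE : 0 ≤ ∑ j ∈ s, w j * l j ^ (-α) :=
    sum_nonneg fun j hj => mul_nonneg (hw j hj) (Real.rpow_nonneg (hl j hj).le _)
  have hL : 0 ≤ ∑ j ∈ s, l j := sum_nonneg fun j hj => (hl j hj).le
  have holder := Real.inner_le_Lp_mul_Lq_of_nonneg s hpq
    (f := fun j => (w j * l j ^ (-α)) ^ (1 / (1 + α))) (g := fun j => l j ^ (α / (1 + α)))
    (fun j hj => Real.rpow_nonneg (mul_nonneg (hw j hj) (Real.rpow_nonneg (hl j hj).le _)) _)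
    (fun j hj => Real.rpow_nonneg (hl j hj).le _)
  have hsum : ∑ j ∈ s, (w j * l j ^ (-α)) ^ (1 / (1 + α)) * l j ^ (α / (1 + α)) =
      ∑ j ∈ s, w j ^ (1 / (1 + α)) := by
    refine sum_congr rfl fun j hj => ?_
    have hlj := hl j hj
    rw [Real.mul_rpow (hw j hj) (Real.rpow_nonneg hlj.le _), ← Real.rpow_mul hlj.le, mul_assoc,
      ← Real.rpow_add hlj]
    rw [show -α * (1 / (1 + α)) + α / (1 + α) = 0 by ring, Real.rpow_zero, mul_one]
  have hf : ∑ j ∈ s, ((w j * l j ^ (-α)) ^ (1 / (1 + α))) ^ (1 + α) =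
      ∑ j ∈ s, w j * l j ^ (-α) := by
    refine sum_congr rfl fun j hj => ?_
    rw [← Real.rpow_mul (mul_nonneg (hw j hj) (Real.rpow_nonneg (hl j hj).le _)),
      one_div_mul_cancel h1.ne', Real.rpow_one]
  have hg : ∑ j ∈ s, (l j ^ (α / (1 + α))) ^ ((1 + α) / α) = ∑ j ∈ s, l j := by
    refine sum_congr rfl fun j hj => ?_
    rw [← Real.rpow_mul (hl j hj).le, show α / (1 + α) * ((1 + α) / α) = 1 by field_simp,
      Real.rpow_one]
  rw [hsum, hf, hg] at holder
  calc (∑ j ∈ s, w j ^ (1 / (1 + α))) ^ ((1 + α) / α)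
      ≤ ((∑ j ∈ s, w j * l j ^ (-α)) ^ (1 / (1 + α)) *
          (∑ j ∈ s, l j) ^ (1 / ((1 + α) / α))) ^ ((1 + α) / α) :=
        Real.rpow_le_rpow (sum_nonneg fun j hj => Real.rpow_nonneg (hw j hj) _) holder
          (by positivity)
    _ = (∑ j ∈ s, w j * l j ^ (-α)) ^ (1 / α) * ∑ j ∈ s, l j := by
        rw [Real.mul_rpow (Real.rpow_nonneg hE _) (Real.rpow_nonneg hL _), ← Real.rpow_mul hE,
          ← Real.rpow_mul hL, show 1 / (1 + α) * ((1 + α) / α) = 1 / α by field_simp,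
          show 1 / ((1 + α) / α) * ((1 + α) / α) = 1 by field_simp, Real.rpow_one]


/-- Multilevel quasi-optimality: any feasible (K̂, (l̂_j)) with error bound ≤ ε satisfies
K̂ ≥ K(2ε) and has total cost at least the explicit multilevel cost at tolerance 2ε. -/
theorem stmt7 (c α e₀ : ℝ) (hc : c ∈ Set.Ioo (0:ℝ) 1) (hα : 0 < α) (he₀ : 0 < e₀)
    (ε : ℝ) (hε : 0 < ε) (hεe : ε < e₀)
    (K2 : ℕ) (hK2 : K2 = ⌈Real.log (2 * ε / (2 * e₀)) / Real.log c⌉₊)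
    (Kh : ℕ) (lh : ℕ → ℝ) (hlh : ∀ j < Kh, 0 < lh j)
    (hfeas : c ^ Kh * e₀ + ∑ j ∈ Finset.range Kh, c ^ (Kh - 1 - j) * lh j ^ (-α) ≤ ε) :
    K2 ≤ Kh ∧
    ε ^ (-1/α) * ((1 - c ^ ((K2:ℝ)/(1+α))) / (1 - c ^ ((1:ℝ)/(1+α)))) ^ ((1+α)/α) ≤
      ∑ j ∈ Finset.range Kh, lh j := by
  obtain ⟨hc0, hc1⟩ := hc
  have hw : ∀ j ∈ Finset.range Kh, 0 ≤ c ^ (Kh - 1 - j) := fun j _ => by positivity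
  have hl : ∀ j ∈ Finset.range Kh, 0 < lh j := fun j hj => hlh j (Finset.mem_range.mp hj)
  have hE : 0 ≤ ∑ j ∈ Finset.range Kh, c ^ (Kh - 1 - j) * lh j ^ (-α) :=
    Finset.sum_nonneg fun j hj => mul_nonneg (hw j hj) (Real.rpow_nonneg (hl j hj).le _)
  have hL : 0 ≤ ∑ j ∈ Finset.range Kh, lh j := Finset.sum_nonneg fun j hj => (hl j hj).le
  have hK : K2 ≤ Kh := by
    have hpow : c ^ Kh ≤ 2 * ε / (2 * e₀) := by
      rw [mul_div_mul_left _ _ two_ne_zero, le_div_iff₀ he₀]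
      linarith
    have hlog := Real.log_le_log (by positivity) hpow
    rw [Real.log_pow] at hlog
    rw [hK2]
    exact Nat.ceil_le.mpr ((div_le_iff_of_neg (Real.log_neg hc0 hc1)).mpr hlog)
  refine ⟨hK, ?_⟩
  have hα1 : 0 < 1 + α := by positivity
  set r : ℝ := c ^ ((1:ℝ) / (1 + α)) with hr
  have hr0 : 0 < r := Real.rpow_pos_of_pos hc0 _
  have hr1 : r < 1 := Real.rpow_lt_one hc0.le hc1 (by positivity)
  have hrK : c ^ ((K2:ℝ) / (1 + α)) = r ^ K2 := by
    rw [hr, ← Real.rpow_mul_natCast hc0.le, one_div_mul_eq_div]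
  have hgeom : (1 - r ^ K2) / (1 - r) ≤
      ∑ j ∈ Finset.range Kh, (c ^ (Kh - 1 - j)) ^ ((1:ℝ) / (1 + α)) := by
    have hterm : ∀ n : ℕ, (c ^ n) ^ ((1:ℝ) / (1 + α)) = r ^ n := fun n => by
      rw [hr, Real.rpow_pow_comm hc0.le]
    simp only [hterm]
    have hr1' : 0 < 1 - r := sub_pos.mpr hr1
    rw [Finset.sum_range_reflect (fun i => r ^ i) Kh, div_le_iff₀ hr1', geom_sum_mul_neg]
    exact sub_le_sub_left (pow_le_pow_of_le_one hr0.le hr1.le hK) 1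
  have hbase : 0 ≤ (1 - r ^ K2) / (1 - r) :=
    div_nonneg (sub_nonneg.mpr (pow_le_one₀ hr0.le hr1.le)) (sub_nonneg.mpr hr1.le)
  have hEε : ∑ j ∈ Finset.range Kh, c ^ (Kh - 1 - j) * lh j ^ (-α) ≤ ε := by
    have : 0 < c ^ Kh * e₀ := by positivity
    linarith
  have hcost : ((1 - r ^ K2) / (1 - r)) ^ ((1 + α) / α) ≤
      ε ^ (1 / α) * ∑ j ∈ Finset.range Kh, lh j :=
    calc ((1 - r ^ K2) / (1 - r)) ^ ((1 + α) / α)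
        ≤ (∑ j ∈ Finset.range Kh, (c ^ (Kh - 1 - j)) ^ ((1:ℝ) / (1 + α))) ^ ((1 + α) / α) :=
          Real.rpow_le_rpow hbase hgeom (by positivity)
      _ ≤ (∑ j ∈ Finset.range Kh, c ^ (Kh - 1 - j) * lh j ^ (-α)) ^ (1 / α) *
            ∑ j ∈ Finset.range Kh, lh j :=
          sum_rpow_le_weighted_error_mul_cost _ hα (fun j => c ^ (Kh - 1 - j)) lh hw hl
      _ ≤ ε ^ (1 / α) * ∑ j ∈ Finset.range Kh, lh j :=
          mul_le_mul_of_nonneg_right (Real.rpow_le_rpow hE hEε (by positivity)) hL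
  rw [hrK, neg_div, Real.rpow_neg hε.le]
  exact (inv_mul_le_iff₀ (Real.rpow_pos_of_pos hε _)).mpr hcost
end

section
/- Let X be a real Hilbert space, Φ : X → ℝ Fréchet differentiable, μ-strongly convex and L-smooth with 0 < μ ≤ L, with unique minimizer x* ∈ X. Let 0 < η ≤ 1/L, α > 0, and suppose for each level l > 0 there is a map g_l : X → X with ‖∇Φ(x) − g_l(x)‖ ≤ l^{-α}/η for all x ∈ X. Let (l_k)_{k≥0} be any levels with l_k ≥ 1 and define the inexact gradient iteration x_{k+1} = x_k − η·g_{l_k}(x_k) from some x_0 ∈ X. Then e_k := ‖x_k − x*‖ satisfies e_{k+1} ≤ √(1 − ημ)·e_k + l_k^{-α} for all k ∈ ℕ. -/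
open scoped RealInnerProductSpace

/-- One exact gradient step with step size `η ≤ 1/L` contracts the squared distance to a minimizer
by the factor `1 - ημ`. Both convexity and smoothness are only needed at the current point. -/
theorem norm_gradient_step_sub_sq_le {X : Type*} [NormedAddCommGroup X] [InnerProductSpace ℝ X]
    {Φ : X → ℝ} {z G xstar : X} {μ L η : ℝ}
    (hsc : ∀ y, Φ z + ⟪G, y - z⟫ + μ / 2 * ‖y - z‖ ^ 2 ≤ Φ y)
    (hsm : ∀ y, Φ y ≤ Φ z + ⟪G, y - z⟫ + L / 2 * ‖y - z‖ ^ 2)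
    (hmin : ∀ y, Φ xstar ≤ Φ y) (hη0 : 0 ≤ η) (hηL : η * L ≤ 1) :
    ‖z - η • G - xstar‖ ^ 2 ≤ (1 - η * μ) * ‖z - xstar‖ ^ 2 := by
  have hconv := hsc xstar
  have hdescent := (hmin _).trans (hsm (z - η • G))
  rw [← neg_sub z xstar, inner_neg_right, norm_neg] at hconv
  rw [sub_sub_cancel_left, inner_neg_right, norm_neg, inner_smul_right, norm_smul,
    real_inner_self_eq_norm_sq, Real.norm_of_nonneg hη0] at hdescent
  have hexpand : ‖z - η • G - xstar‖ ^ 2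
      = ‖z - xstar‖ ^ 2 - 2 * η * ⟪G, z - xstar⟫ + η ^ 2 * ‖G‖ ^ 2 := by
    rw [sub_right_comm, norm_sub_sq_real, inner_smul_right, norm_smul, Real.norm_of_nonneg hη0,
      real_inner_comm]
    ring
  have hdecrease : η / 2 * ‖G‖ ^ 2 ≤ Φ z - Φ xstar := by
    have := mul_le_mul_of_nonneg_right hηL (mul_nonneg hη0 (sq_nonneg ‖G‖))
    linarith
  have hinner : η / 2 * ‖G‖ ^ 2 + μ / 2 * ‖z - xstar‖ ^ 2 ≤ ⟪G, z - xstar⟫ := by linarith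
  rw [hexpand]
  linarith [mul_le_mul_of_nonneg_left hinner hη0]

/-- Inexact gradient descent satisfies the abstract error decay:
e_{k+1} ≤ √(1 − ημ)·e_k + l_k^{-α} with e_k = ‖x_k − x*‖. -/
theorem stmt10 {X : Type*} [NormedAddCommGroup X] [InnerProductSpace ℝ X] [CompleteSpace X]
    (Φ : X → ℝ) (gradΦ : X → X) (hgrad : ∀ x, HasGradientAt Φ (gradΦ x) x)
    (μ L : ℝ) (hμ : 0 < μ) (hμL : μ ≤ L)
    (hsc : ∀ x y, Φ x + ⟪gradΦ x, y - x⟫ + μ/2 * ‖y - x‖^2 ≤ Φ y)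
    (hsm : ∀ x y, Φ y ≤ Φ x + ⟪gradΦ x, y - x⟫ + L/2 * ‖y - x‖^2)
    (xstar : X) (hmin : ∀ y, Φ xstar ≤ Φ y)
    (η : ℝ) (hη0 : 0 < η) (hη : η ≤ 1/L)
    (α : ℝ) (hα : 0 < α)
    (g : ℝ → X → X) (hg : ∀ l, 0 < l → ∀ x, ‖gradΦ x - g l x‖ ≤ l ^ (-α) / η)
    (lev : ℕ → ℝ) (hlev : ∀ k, 1 ≤ lev k)
    (x : ℕ → X) (hstep : ∀ k, x (k + 1) = x k - η • g (lev k) (x k)) :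
    ∀ k, ‖x (k + 1) - xstar‖ ≤ Real.sqrt (1 - η * μ) * ‖x k - xstar‖ + lev k ^ (-α) := by
  intro k
  have hL : 0 < L := hμ.trans_le hμL
  have hηL : η * L ≤ 1 := (le_div_iff₀ hL).1 hη
  have hcoef : 0 ≤ 1 - η * μ := by linarith [mul_le_mul_of_nonneg_left hμL hη0.le]
  have hexact : ‖x k - η • gradΦ (x k) - xstar‖ ≤ √(1 - η * μ) * ‖x k - xstar‖ := by
    refine (sq_le_sq₀ (norm_nonneg _) (by positivity)).1 ?_
    rw [mul_pow, Real.sq_sqrt hcoef]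
    exact norm_gradient_step_sub_sq_le (hsc (x k)) (hsm (x k)) hmin hη0.le hηL
  have herror : ‖η • (gradΦ (x k) - g (lev k) (x k))‖ ≤ lev k ^ (-α) := by
    rw [norm_smul, Real.norm_of_nonneg hη0.le, mul_comm, ← le_div_iff₀ hη0]
    exact hg _ (zero_lt_one.trans_le (hlev k)) _
  have hsplit : x (k + 1) - xstar
      = (x k - η • gradΦ (x k) - xstar) + η • (gradΦ (x k) - g (lev k) (x k)) := by
    rw [hstep, smul_sub]
    abel
  rw [hsplit]
  exact (norm_add_le _ _).trans (add_le_add hexact herror)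
end

section
/- Let X be a real Hilbert space, Φ : X → ℝ Fréchet differentiable, μ-strongly convex and L-smooth with 0 < μ ≤ L, with unique minimizer x*. Let (Ω, F, P) be a probability space, 0 < η ≤ 1/L, α > 0, and let (l_k)_{k≥0} be levels with l_k ≥ 1. Suppose (G_k)_{k≥0} are X-valued random variables and (x_k)_{k≥0} are X-valued random variables with x_0 constant, x_{k+1} = x_k − η·G_k, and E[‖∇Φ(x_k) − G_k‖] ≤ l_k^{-α}/η·(something ≤ l_k^{-α}/η) for each k, i.e. E[‖∇Φ(x_k) − G_k‖] ≤ l_k^{-α}/η. Then e_k := E[‖x_k − x*‖] satisfies e_{k+1} ≤ √(1 − ημ)·e_k + l_k^{-α} for all k ∈ ℕ. -/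
open scoped RealInnerProductSpace
open MeasureTheory

/-- One gradient step of length at most `1 / L` contracts the distance to a minimizer `z` by the
factor `√(1 - η μ)`. Strong convexity is only needed between `x` and `z`, and smoothness only
along the step. -/
theorem norm_gradient_step_sub_le {X : Type*} [NormedAddCommGroup X] [InnerProductSpace ℝ X]
    {Φ : X → ℝ} {x g z : X} {μ L η : ℝ} (hη0 : 0 ≤ η) (hηL : η * L ≤ 1) (hημ : η * μ ≤ 1)
    (hsc : Φ x + ⟪g, z - x⟫ + μ / 2 * ‖z - x‖ ^ 2 ≤ Φ z)
    (hsm : Φ (x - η • g) ≤ Φ x + ⟪g, x - η • g - x⟫ + L / 2 * ‖x - η • g - x‖ ^ 2)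
    (hmin : Φ z ≤ Φ (x - η • g)) :
    ‖x - η • g - z‖ ≤ Real.sqrt (1 - η * μ) * ‖x - z‖ := by
  have hinner : ⟪g, z - x⟫ = -⟪x - z, g⟫ := by
    rw [← neg_sub x z, inner_neg_right, real_inner_comm]
  have hdescent : η / 2 * ‖g‖ ^ 2 ≤ Φ x - Φ z := by
    have hstep : x - η • g - x = -(η • g) := by abel
    rw [hstep, inner_neg_right, real_inner_smul_right, real_inner_self_eq_norm_sq, norm_neg,
      norm_smul, mul_pow, Real.norm_eq_abs, sq_abs] at hsm
    have := mul_nonneg (mul_nonneg hη0 (sq_nonneg ‖g‖)) (sub_nonneg.2 hηL)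
    nlinarith
  have hexpand : ‖x - η • g - z‖ ^ 2 =
      ‖x - z‖ ^ 2 - 2 * η * ⟪x - z, g⟫ + η ^ 2 * ‖g‖ ^ 2 := by
    rw [sub_right_comm, norm_sub_sq_real, real_inner_smul_right, norm_smul, mul_pow,
      Real.norm_eq_abs, sq_abs]
    ring
  refine abs_le_of_sq_le_sq' ?_ (by positivity) |>.2
  rw [mul_pow, Real.sq_sqrt (by linarith), hexpand]
  rw [hinner, norm_sub_rev z x] at hsc
  have hgap : 0 ≤ η * (⟪x - z, g⟫ - μ / 2 * ‖x - z‖ ^ 2 - η / 2 * ‖g‖ ^ 2) :=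
    mul_nonneg hη0 (by linarith)
  nlinarith

/-- Stochastic gradient descent with approximate stochastic gradients satisfies the
abstract error decay in expectation: e_{k+1} ≤ √(1 − ημ)·e_k + l_k^{-α} with
e_k = E‖x_k − x*‖. -/
theorem stmt12 {X : Type*} [NormedAddCommGroup X] [InnerProductSpace ℝ X] [CompleteSpace X]
    (Φ : X → ℝ) (gradΦ : X → X) (hgrad : ∀ x, HasGradientAt Φ (gradΦ x) x)
    (μ L : ℝ) (hμ : 0 < μ) (hμL : μ ≤ L)
    (hsc : ∀ x y, Φ x + ⟪gradΦ x, y - x⟫ + μ/2 * ‖y - x‖^2 ≤ Φ y)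
    (hsm : ∀ x y, Φ y ≤ Φ x + ⟪gradΦ x, y - x⟫ + L/2 * ‖y - x‖^2)
    (xstar : X) (hmin : ∀ y, Φ xstar ≤ Φ y)
    (η : ℝ) (hη0 : 0 < η) (hη : η ≤ 1/L)
    (α : ℝ) (hα : 0 < α)
    {Ω : Type*} [MeasurableSpace Ω] (P : Measure Ω) [IsProbabilityMeasure P]
    (lev : ℕ → ℝ) (hlev : ∀ k, 1 ≤ lev k)
    (G : ℕ → Ω → X) (x : ℕ → Ω → X) (x₀ : X)
    (hx0 : ∀ ω, x 0 ω = x₀)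
    (hstep : ∀ k ω, x (k + 1) ω = x k ω - η • G k ω)
    (hint1 : ∀ k, Integrable (fun ω => ‖x k ω - xstar‖) P)
    (hint2 : ∀ k, Integrable (fun ω => ‖gradΦ (x k ω) - G k ω‖) P)
    (hG : ∀ k, ∫ ω, ‖gradΦ (x k ω) - G k ω‖ ∂P ≤ lev k ^ (-α) / η) :
    ∀ k, ∫ ω, ‖x (k + 1) ω - xstar‖ ∂P ≤
      Real.sqrt (1 - η * μ) * ∫ ω, ‖x k ω - xstar‖ ∂P + lev k ^ (-α) := by
  intro k
  have hL : 0 < L := hμ.trans_le hμL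
  have hηL : η * L ≤ 1 := (le_div_iff₀ hL).1 hη
  have hημ : η * μ ≤ 1 := (mul_le_mul_of_nonneg_left hμL hη0.le).trans hηL
  have hpointwise : ∀ ω, ‖x (k + 1) ω - xstar‖ ≤
      Real.sqrt (1 - η * μ) * ‖x k ω - xstar‖ + η * ‖gradΦ (x k ω) - G k ω‖ := by
    intro ω
    have hsplit : x (k + 1) ω - xstar =
        (x k ω - η • gradΦ (x k ω) - xstar) + η • (gradΦ (x k ω) - G k ω) := by
      rw [hstep, smul_sub]
      abel
    calc ‖x (k + 1) ω - xstar‖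
        ≤ ‖x k ω - η • gradΦ (x k ω) - xstar‖ + ‖η • (gradΦ (x k ω) - G k ω)‖ :=
          hsplit ▸ norm_add_le _ _
      _ ≤ _ := by
          rw [norm_smul, Real.norm_of_nonneg hη0.le]
          gcongr
          exact norm_gradient_step_sub_le hη0.le hηL hημ (hsc _ _) (hsm _ _) (hmin _)
  calc ∫ ω, ‖x (k + 1) ω - xstar‖ ∂P
      ≤ ∫ ω, (Real.sqrt (1 - η * μ) * ‖x k ω - xstar‖ + η * ‖gradΦ (x k ω) - G k ω‖) ∂P :=
        integral_mono (hint1 _) (((hint1 k).const_mul _).add ((hint2 k).const_mul _)) hpointwise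
    _ = Real.sqrt (1 - η * μ) * ∫ ω, ‖x k ω - xstar‖ ∂P +
          η * ∫ ω, ‖gradΦ (x k ω) - G k ω‖ ∂P := by
        rw [integral_add ((hint1 k).const_mul _) ((hint2 k).const_mul _),
          integral_const_mul, integral_const_mul]
    _ ≤ _ := by
        gcongr
        exact (le_div_iff₀' hη0).1 (hG k)
end

section
/- Fix α > 0 and η ∈ (0,1), and consider the one-dimensional iteration x_{k+1} = (1 − η)·x_k + η·l_k^{-α} with x_0 ≥ 0 (gradient descent with step η on Φ(x) = x²/2 using the biased approximate gradients ∇Φ_l(x) = x − l^{-α}, whose minimizer is x* = 0). Then for every ε > 0, every K ∈ ℕ with K ≥ 1, and every choice of positive levels (l_j)_{j=0}^{K-1} such that |x_K − x*| = |x_K| ≤ ε, the total cost satisfies Σ_{j=0}^{K-1} l_j ≥ η^{1/α}·ε^{-1/α}. -/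
/-- Sharpness example: for gradient descent on Φ(x) = x²/2 with biased approximate
gradients ∇Φ_l(x) = x − l^{-α}, achieving |x_K| ≤ ε forces total cost ≥ η^{1/α}·ε^{-1/α}. -/
theorem stmt19 (α η : ℝ) (hα : 0 < α) (hη : η ∈ Set.Ioo (0:ℝ) 1)
    (x : ℕ → ℝ) (hx0 : 0 ≤ x 0)
    (l : ℕ → ℝ) (hl : ∀ j, 0 < l j)
    (hrec : ∀ k, x (k + 1) = (1 - η) * x k + η * l k ^ (-α))
    (ε : ℝ) (hε : 0 < ε) (K : ℕ) (hK : 1 ≤ K)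
    (hxK : |x K - 0| ≤ ε) :
    η ^ (1/α) * ε ^ (-1/α) ≤ ∑ j ∈ Finset.range K, l j := by
  obtain ⟨hη0, hη1⟩ := hη
  have hη1' : 0 ≤ 1 - η := by linarith
  have hpow (j : ℕ) : 0 < l j ^ (-α) := Real.rpow_pos_of_pos (hl j) _
  have hx (k : ℕ) : 0 ≤ x k := by
    induction k with
    | zero => exact hx0
    | succ k ih =>
      rw [hrec]
      have := hpow k
      positivity
  obtain ⟨n, rfl⟩ : ∃ n, K = n + 1 := ⟨K - 1, by omega⟩
  have hbias : l n ^ (-α) ≤ ε / η := by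
    rw [le_div_iff₀ hη0]
    have h1 := (le_abs_self _).trans hxK
    rw [hrec] at h1
    have h2 := mul_nonneg hη1' (hx n)
    linarith
  calc η ^ (1/α) * ε ^ (-1/α) = (ε / η) ^ (-1/α) := by
        rw [Real.div_rpow hε.le hη0.le, neg_div, Real.rpow_neg hη0.le, div_inv_eq_mul, mul_comm]
    _ ≤ (l n ^ (-α)) ^ (-1/α) :=
        Real.rpow_le_rpow_of_nonpos (hpow n) hbias
          (div_nonpos_of_nonpos_of_nonneg (by norm_num) hα.le)
    _ = l n := by
        rw [← Real.rpow_mul (hl n).le, show -α * (-1/α) = 1 by field_simp, Real.rpow_one]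
    _ ≤ ∑ j ∈ Finset.range (n + 1), l j :=
        Finset.single_le_sum (fun j _ => (hl j).le) (Finset.self_mem_range_succ n)
end
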